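/- arXiv:1711.05994 — 2 statements merged into one kernel-verified Lean document; each statement's English description precedes it below -/
import Mathlib

section
/- A rational function f : Σ* → ℝ admits a singular value automaton if and only if f ∈ ℓ²(Σ), i.e. if and only if Σ_{x∈Σ*} f(x)² < ∞. -/
open scoped ENNReal
open scoped Kronecker
open Matrix

noncomputable section

/-- A weighted finite automaton of dimension `n` over alphabet `S`,
with initial weights, final weights and transition matrices. -/
structure WFA (S : Type*) (n : ℕ) where
  init : Fin n → ℝ
  final : Fin n → ℝ
  trans : S → Matrix (Fin n) (Fin n) ℝ

namespace WFA

variable {S : Type*} {n : ℕ}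

/-- `A_x = A_{x₁} ⋯ A_{x_t}` (identity for the empty string). -/
def matOf (M : WFA S n) (x : List S) : Matrix (Fin n) (Fin n) ℝ :=
  (x.map M.trans).prod

/-- The function computed by the WFA: `f_A(x) = αᵀ A_x β`. -/
def f (M : WFA S n) (x : List S) : ℝ :=
  M.init ⬝ᵥ (M.matOf x).mulVec M.final

/-- Row `p` of the forward matrix: `αᵀ A_p`. -/
def fwd (M : WFA S n) (x : List S) : Fin n → ℝ :=
  Matrix.vecMul M.init (M.matOf x)

/-- Row `s` of the backward matrix: `(A_s β)ᵀ`. -/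
def bwd (M : WFA S n) (x : List S) : Fin n → ℝ :=
  (M.matOf x).mulVec M.final

/-- `M` is a minimal WFA: no WFA of strictly smaller dimension computes the same function. -/
def Min (M : WFA S n) : Prop :=
  ∀ m : ℕ, (∃ B : WFA S m, B.f = M.f) → n ≤ m

/-- The reachability Gramian `G_p = Pᵀ P` is well-defined: all its defining sums converge. -/
def GpDefined (M : WFA S n) : Prop :=
  ∀ i j, Summable fun x : List S => M.fwd x i * M.fwd x j

/-- The observability Gramian `G_s = Sᵀ S` is well-defined: all its defining sums converge. -/
def GsDefined (M : WFA S n) : Prop :=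
  ∀ i j, Summable fun x : List S => M.bwd x i * M.bwd x j

/-- The reachability Gramian `G_p = Pᵀ P`. -/
def Gp (M : WFA S n) : Matrix (Fin n) (Fin n) ℝ :=
  Matrix.of fun i j => ∑' x : List S, M.fwd x i * M.fwd x j

/-- The observability Gramian `G_s = Sᵀ S`. -/
def Gs (M : WFA S n) : Matrix (Fin n) (Fin n) ℝ :=
  Matrix.of fun i j => ∑' x : List S, M.bwd x i * M.bwd x j

/-- Truncation of a WFA to its first `m` states. -/
def trunc (M : WFA S n) (m : ℕ) (h : m ≤ n) : WFA S m where
  init := fun i => M.init (Fin.castLE h i)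
  final := fun i => M.final (Fin.castLE h i)
  trans := fun a => Matrix.of fun i j => M.trans a (Fin.castLE h i) (Fin.castLE h j)

end WFA

/-- A function `f : Σ* → ℝ` is rational if it is computed by some WFA. -/
def IsRational {S : Type*} (f : List S → ℝ) : Prop :=
  ∃ (n : ℕ) (M : WFA S n), M.f = f

/-- Spectral radius of a real square matrix: the largest modulus of its complex eigenvalues. -/
def specRad {d : Type*} [Fintype d] [DecidableEq d] (M : Matrix d d ℝ) : ℝ≥0∞ :=
  spectralRadius ℂ (M.map (algebraMap ℝ ℂ))

/-- Induced ∞-norm of a matrix: maximum absolute row sum. -/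
def normInfM {d e : Type*} [Fintype d] [Fintype e] (M : Matrix d e ℝ) : ℝ :=
  ⨆ i, ∑ j, |M i j|

/-- Induced 1-norm of a matrix: maximum absolute column sum. -/
def normOneM {d e : Type*} [Fintype d] [Fintype e] (M : Matrix d e ℝ) : ℝ :=
  ⨆ j, ∑ i, |M i j|

/-- The `p`-norm of a finite-dimensional real vector, `1 ≤ p ≤ ∞`. -/
def vecPNorm {d : Type*} [Fintype d] (p : ℝ≥0∞) (v : d → ℝ) : ℝ :=
  if p = ⊤ then ⨆ i, |v i| else (∑ i, |v i| ^ p.toReal) ^ (1 / p.toReal)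

/-- The induced matrix `p`-norm `‖M‖_p = sup_{‖v‖_p = 1} ‖Mv‖_p`. -/
def inducedPNorm {d : Type*} [Fintype d] (p : ℝ≥0∞) (M : Matrix d d ℝ) : ℝ :=
  sSup {r | ∃ v : d → ℝ, vecPNorm p v = 1 ∧ r = vecPNorm p (M.mulVec v)}

/-- The operator norm of the Hankel operator of `f` on `ℓ²`. -/
def hankelOpNorm {S : Type*} (f : List S → ℝ) : ℝ :=
  sSup {r | ∃ g : List S → ℝ, (Summable fun y => g y ^ 2) ∧ (∑' y, g y ^ 2) ≤ 1 ∧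
    (Summable fun x : List S => (∑' y : List S, f (x ++ y) * g y) ^ 2) ∧
    r = Real.sqrt (∑' x : List S, (∑' y : List S, f (x ++ y) * g y) ^ 2)}

end
/-- `f` admits a singular value automaton: a minimal WFA whose forward and backward matrices
are `U D^{1/2}` and `V D^{1/2}` for a compact SVD `H_f = U D Vᵀ` of its Hankel matrix. -/
def HasSVA {S : Type*} (f : List S → ℝ) : Prop :=
  ∃ (n : ℕ) (M : WFA S n) (U V : List S → Fin n → ℝ) (σ : Fin n → ℝ),
    M.f = f ∧ M.Min ∧
    (∀ i j, Summable fun x : List S => U x i * U x j) ∧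
    (∀ i j, Summable fun x : List S => V x i * V x j) ∧
    (∀ i j, (∑' x : List S, U x i * U x j) = if i = j then (1 : ℝ) else 0) ∧
    (∀ i j, (∑' x : List S, V x i * V x j) = if i = j then (1 : ℝ) else 0) ∧
    (∀ i, 0 < σ i) ∧ (∀ i j : Fin n, i ≤ j → σ j ≤ σ i) ∧
    (∀ p s : List S, f (p ++ s) = ∑ i : Fin n, U p i * σ i * V s i) ∧
    (∀ p i, M.fwd p i = U p i * Real.sqrt (σ i)) ∧
    (∀ s i, M.bwd s i = V s i * Real.sqrt (σ i))

/-- A function with a singular value automaton is square-summable: its values are the first row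
of the Hankel matrix. -/
theorem HasSVA.summable_sq {S : Type*} {f : List S → ℝ} (h : HasSVA f) :
    Summable fun x : List S => f x ^ 2 := by
  obtain ⟨n, M, U, V, σ, -, -, -, hV, -, -, -, -, hUV, -, -⟩ := h
  have key : ∀ x, f x ^ 2 = ∑ i, ∑ j, (U [] i * σ i * (U [] j * σ j)) * (V x i * V x j) := by
    intro x
    rw [← List.nil_append x, hUV, sq, Finset.sum_mul_sum]
    refine Finset.sum_congr rfl fun i _ => Finset.sum_congr rfl fun j _ => ?_
    rw [List.nil_append]
    ring
  simp_rw [key]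
  exact summable_sum fun i _ => summable_sum fun j _ => (hV i j).mul_left _

/-- Spectral decomposition of a real positive definite matrix with decreasing eigenvalues. -/
theorem Matrix.PosDef.exists_orthogonal_diagonal {n : ℕ} {A : Matrix (Fin n) (Fin n) ℝ}
    (hA : A.PosDef) :
    ∃ (W : Matrix (Fin n) (Fin n) ℝ) (d : Fin n → ℝ), Wᵀ * W = 1 ∧ Wᵀ * A * W = diagonal d ∧
      (∀ i, 0 < d i) ∧ Antitone d := by
  let e := Tuple.sort fun i => -hA.isHermitian.eigenvalues i
  let W : Matrix (Fin n) (Fin n) ℝ := hA.isHermitian.eigenvectorUnitary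
  have hW : Wᵀ * W = 1 := by
    have := Unitary.coe_star_mul_self hA.isHermitian.eigenvectorUnitary
    rwa [star_eq_conjTranspose, conjTranspose_eq_transpose_of_trivial] at this
  have hWA : Wᵀ * A * W = diagonal hA.isHermitian.eigenvalues := by
    have := hA.isHermitian.conjStarAlgAut_star_eigenvectorUnitary
    rw [Unitary.conjStarAlgAut_apply] at this
    simpa [star_eq_conjTranspose, conjTranspose_eq_transpose_of_trivial, W] using this
  refine ⟨W.submatrix id e, hA.isHermitian.eigenvalues ∘ e, ?_, ?_,
    fun i => hA.eigenvalues_pos _, fun i j hij => ?_⟩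
  · have := congrArg (fun X => X.submatrix e e) hW
    simpa [← submatrix_mul_equiv _ _ e (Equiv.refl _) e] using this
  · ext i j
    have := congrFun₂ hWA (e i) (e j)
    simpa [mul_apply, diagonal_apply] using this
  · exact neg_le_neg_iff.mp (Tuple.monotone_sort (fun i => -hA.isHermitian.eigenvalues i) hij)

/-- Two positive definite forms, one on a space and one on its dual, are balanced by a common
change of basis. -/
theorem Matrix.PosDef.exists_balancing {n : ℕ} {G H : Matrix (Fin n) (Fin n) ℝ}
    (hG : G.PosDef) (hH : H.PosDef) :
    ∃ (Q R : Matrix (Fin n) (Fin n) ℝ) (σ : Fin n → ℝ), Q * R = 1 ∧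
      Qᵀ * G * Q = diagonal σ ∧ R * H * Rᵀ = diagonal σ ∧ (∀ i, 0 < σ i) ∧ Antitone σ := by
  obtain ⟨W, d, hW, hWG, hd, -⟩ := hG.exists_orthogonal_diagonal
  have hW' : W * Wᵀ = 1 := mul_eq_one_comm.mp hW
  have hsd : ∀ i, √(d i) ≠ 0 := fun i => (Real.sqrt_pos.mpr (hd i)).ne'
  let B : Matrix (Fin n) (Fin n) ℝ := diagonal (fun i => √(d i)) * Wᵀ
  let C : Matrix (Fin n) (Fin n) ℝ := W * diagonal fun i => (√(d i))⁻¹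
  have hCB : C * B = 1 := by
    calc C * B = W * (diagonal (fun i => (√(d i))⁻¹) * diagonal fun i => √(d i)) * Wᵀ := by
          simp only [B, C, Matrix.mul_assoc]
      _ = 1 := by simp [diagonal_mul_diagonal, hsd, hW']
  have hCG : Cᵀ * G * C = 1 := by
    calc Cᵀ * G * C = diagonal (fun i => (√(d i))⁻¹) * (Wᵀ * G * W) *
          diagonal fun i => (√(d i))⁻¹ := by
          simp only [C, Matrix.mul_assoc, transpose_mul, diagonal_transpose]
      _ = 1 := by
          rw [hWG, diagonal_mul_diagonal, diagonal_mul_diagonal, ← diagonal_one]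
          congr 1; funext i
          have := Real.mul_self_sqrt (hd i).le
          have := hsd i
          field_simp
          nlinarith
  have hK : (B * H * Bᵀ).PosDef := by
    have hinj : Function.Injective B.vecMul := by
      refine vecMul_injective_of_isUnit ?_
      exact IsUnit.of_mul_eq_one C (mul_eq_one_comm.mp hCB)
    simpa [conjTranspose_eq_transpose_of_trivial] using hH.mul_mul_conjTranspose_same hinj
  obtain ⟨Z, e, hZ, hZK, he, hemono⟩ := hK.exists_orthogonal_diagonal
  have hZ' : Z * Zᵀ = 1 := mul_eq_one_comm.mp hZ
  let t : Fin n → ℝ := fun i => √(√(e i))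
  have ht : ∀ i, t i ≠ 0 := fun i => (Real.sqrt_pos.mpr (Real.sqrt_pos.mpr (he i))).ne'
  have ht2 : ∀ i, t i * t i = √(e i) := fun i => Real.mul_self_sqrt (Real.sqrt_nonneg _)
  refine ⟨C * Z * diagonal t, diagonal (fun i => (t i)⁻¹) * Zᵀ * B, fun i => √(e i),
    ?_, ?_, ?_, fun i => Real.sqrt_pos.mpr (he i), fun i j hij => Real.sqrt_le_sqrt (hemono hij)⟩
  · calc _ = C * (Z * (diagonal t * diagonal fun i => (t i)⁻¹) * Zᵀ) * B := by
          simp only [Matrix.mul_assoc]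
      _ = 1 := by simp [diagonal_mul_diagonal, ht, hZ', hCB]
  · calc _ = diagonal t * (Zᵀ * (Cᵀ * G * C) * Z) * diagonal t := by
          simp only [Matrix.mul_assoc, transpose_mul, diagonal_transpose]
      _ = _ := by simp [hCG, hZ, diagonal_mul_diagonal, ht2]
  · calc _ = diagonal (fun i => (t i)⁻¹) * (Zᵀ * (B * H * Bᵀ) * Z) *
          diagonal fun i => (t i)⁻¹ := by
          simp only [Matrix.mul_assoc, transpose_mul, diagonal_transpose, transpose_transpose]
      _ = _ := by
          rw [hZK, diagonal_mul_diagonal, diagonal_mul_diagonal]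
          congr 1; funext i
          have h1 := ht2 i
          have h2 := Real.mul_self_sqrt (he i).le
          have := ht i
          field_simp
          nlinarith

section Gram

variable {ι n : Type*} [Fintype n] {P : ι → n → ℝ}

/-- Polarized quadratic forms of a Gram matrix as sums over the rows. -/
theorem hasSum_gram (hP : ∀ i j, Summable fun x => P x i * P x j) (v w : n → ℝ) :
    HasSum (fun x => (P x ⬝ᵥ v) * (P x ⬝ᵥ w))
      (v ⬝ᵥ (Matrix.of fun i j => ∑' x, P x i * P x j) *ᵥ w) := by
  have key : HasSum (fun x => ∑ i, ∑ j, v i * (P x i * P x j * w j))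
      (∑ i, ∑ j, v i * ((∑' x, P x i * P x j) * w j)) :=
    hasSum_sum fun i _ => hasSum_sum fun j _ =>
      ((hP i j).hasSum.mul_right (w j)).mul_left (v i)
  convert key using 1
  · funext x
    simp only [dotProduct, Finset.sum_mul_sum]
    exact Finset.sum_congr rfl fun i _ => Finset.sum_congr rfl fun j _ => by ring
  · simp [dotProduct, mulVec, Finset.mul_sum]

/-- The Gram matrix of a square-summable family of rows spanning the space is positive definite. -/
theorem posDef_gram (hP : ∀ i j, Summable fun x => P x i * P x j)
    (hspan : Submodule.span ℝ (Set.range P) = ⊤) :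
    (Matrix.of fun i j => ∑' x, P x i * P x j).PosDef := by
  refine Matrix.PosDef.of_dotProduct_mulVec_pos ?_ fun {v} hv => ?_
  · ext i j
    simp [mul_comm]
  · rw [star_trivial]
    have hs := hasSum_gram hP v v
    obtain ⟨x, hx⟩ : ∃ x, P x ⬝ᵥ v ≠ 0 := by
      by_contra! h
      refine hv (dotProduct_self_eq_zero.mp ?_)
      have hmem : v ∈ Submodule.span ℝ (Set.range P) := hspan ▸ Submodule.mem_top
      refine Submodule.span_induction (p := fun w _ => w ⬝ᵥ v = 0) ?_ (by simp) ?_ ?_ hmem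
      · rintro _ ⟨x, rfl⟩
        exact h x
      · intro a b _ _ ha hb
        rw [add_dotProduct, ha, hb, add_zero]
      · intro c a _ ha
        rw [smul_dotProduct, ha, smul_zero]
    rw [← hs.tsum_eq]
    exact hs.summable.tsum_pos (fun x => mul_self_nonneg _) x (mul_self_pos.mpr hx)

end Gram

namespace WFA

variable {S : Type*} {n : ℕ}

theorem matOf_append (M : WFA S n) (x y : List S) : M.matOf (x ++ y) = M.matOf x * M.matOf y := by
  simp [matOf]

theorem f_append (M : WFA S n) (p s : List S) : M.f (p ++ s) = M.fwd p ⬝ᵥ M.bwd s := by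
  rw [f, matOf_append, fwd, bwd, ← mulVec_mulVec, dotProduct_mulVec]

theorem f_eq_dotProduct_bwd (M : WFA S n) (x : List S) : M.f x = M.init ⬝ᵥ M.bwd x := rfl

theorem bwd_cons (M : WFA S n) (a : S) (x : List S) :
    M.bwd (a :: x) = M.trans a *ᵥ M.bwd x := by
  simp [bwd, matOf]

/-- The automaton reading words backwards. -/
def reversal (M : WFA S n) : WFA S n := ⟨M.final, M.init, fun a => (M.trans a)ᵀ⟩

theorem matOf_reversal (M : WFA S n) (x : List S) :
    M.reversal.matOf x = (M.matOf x.reverse)ᵀ := by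
  simp [matOf, reversal, transpose_list_prod, Function.comp_def]

theorem bwd_reversal (M : WFA S n) (x : List S) : M.reversal.bwd x = M.fwd x.reverse := by
  rw [bwd, matOf_reversal, mulVec_transpose]; rfl

theorem fwd_reversal (M : WFA S n) (x : List S) : M.reversal.fwd x = M.bwd x.reverse := by
  rw [fwd, matOf_reversal, vecMul_transpose]; rfl

theorem f_reversal (M : WFA S n) (x : List S) : M.reversal.f x = M.f x.reverse := by
  rw [← List.append_nil x, f_append, fwd_reversal, bwd_reversal, dotProduct_comm, ← f_append]
  simp

theorem Min.reversal {M : WFA S n} (hM : M.Min) : M.reversal.Min := by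
  rintro m ⟨B, hB⟩
  refine hM m ⟨B.reversal, funext fun x => ?_⟩
  rw [f_reversal, hB, f_reversal, List.reverse_reverse]

/-- A minimal automaton is observable. -/
theorem Min.span_bwd {M : WFA S n} (hM : M.Min) :
    Submodule.span ℝ (Set.range M.bwd) = ⊤ := by
  set V := Submodule.span ℝ (Set.range M.bwd) with hV
  obtain ⟨g, hg⟩ := V.subtype.exists_leftInverse_of_injective V.ker_subtype
  let b := Module.finBasis ℝ V
  let E := LinearMap.toMatrix' (V.subtype ∘ₗ b.equivFun.symm.toLinearMap)
  let F := LinearMap.toMatrix' (b.equivFun.toLinearMap ∘ₗ g)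
  have hEF : ∀ v ∈ V, E *ᵥ (F *ᵥ v) = v := by
    intro v hv
    have := LinearMap.congr_fun hg ⟨v, hv⟩
    simp only [LinearMap.comp_apply, Submodule.subtype_apply, LinearMap.id_apply] at this
    simp [E, F, LinearMap.toMatrix'_mulVec, this]
  let B : WFA S (Module.finrank ℝ V) :=
    ⟨M.init ᵥ* E, F *ᵥ M.final, fun a => F * M.trans a * E⟩
  have hmem : ∀ x, M.bwd x ∈ V := fun x => Submodule.subset_span ⟨x, rfl⟩
  have hB : ∀ x, E *ᵥ B.bwd x = M.bwd x := by
    intro x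
    induction x with
    | nil => simpa [bwd, matOf, B] using hEF _ (hmem [])
    | cons a x ih =>
      rw [bwd_cons]
      simp only [B, ← mulVec_mulVec] at ih ⊢
      rw [ih, ← bwd_cons, hEF _ (hmem _)]
  refine Submodule.eq_top_of_finrank_eq (le_antisymm (Submodule.finrank_le V) ?_)
  rw [Module.finrank_fin_fun]
  refine hM _ ⟨B, funext fun x => ?_⟩
  rw [f_eq_dotProduct_bwd, f_eq_dotProduct_bwd, ← hB x, dotProduct_mulVec]

/-- A minimal automaton is reachable. -/
theorem Min.span_fwd {M : WFA S n} (hM : M.Min) :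
    Submodule.span ℝ (Set.range M.fwd) = ⊤ := by
  rw [← hM.reversal.span_bwd]
  congr 1
  ext v
  simp only [Set.mem_range, bwd_reversal]
  exact (List.reverse_surjective.exists (p := fun x => M.fwd x = v))

theorem Min.gpDefined {M : WFA S n} (hM : M.Min) (hf : Summable fun x => M.f x ^ 2) :
    M.GpDefined := by
  have key : ∀ w : Fin n → ℝ, Summable fun p => (M.fwd p ⬝ᵥ w) ^ 2 := by
    intro w
    have hw : w ∈ Submodule.span ℝ (Set.range M.bwd) := hM.span_bwd ▸ Submodule.mem_top
    refine Submodule.span_induction (p := fun w _ => Summable fun p => (M.fwd p ⬝ᵥ w) ^ 2)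
      ?_ (by simp) ?_ ?_ hw
    · rintro _ ⟨s, rfl⟩
      simp_rw [← f_append]
      exact hf.comp_injective (List.append_left_injective s)
    · intro a b _ _ ha hb
      refine Summable.of_nonneg_of_le (fun p => sq_nonneg _) (fun p => ?_)
        ((ha.add hb).mul_left 2)
      rw [dotProduct_add]
      exact add_sq_le
    · intro c a _ ha
      simpa [dotProduct_smul, mul_pow] using ha.mul_left (c ^ 2)
  intro i j
  have hi := key (Pi.single i 1)
  have hj := key (Pi.single j 1)
  simp only [dotProduct_single_one] at hi hj
  refine Summable.of_norm_bounded (hi.add hj) fun p => ?_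
  rw [Real.norm_eq_abs, abs_le]
  constructor <;> nlinarith [sq_nonneg (M.fwd p i + M.fwd p j), sq_nonneg (M.fwd p i - M.fwd p j),
    sq_nonneg (M.fwd p i), sq_nonneg (M.fwd p j)]

theorem Min.gsDefined {M : WFA S n} (hM : M.Min) (hf : Summable fun x => M.f x ^ 2) :
    M.GsDefined := by
  intro i j
  have hrev : Summable fun x => M.reversal.f x ^ 2 := by
    simp_rw [f_reversal]
    exact hf.comp_injective List.reverse_injective
  have := (hM.reversal.gpDefined hrev i j).comp_injective List.reverse_injective
  simpa [Function.comp_def, fwd_reversal] using this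

/-- Change of basis in the state space, with `R` meant to be the inverse of `Q`. -/
def conj (M : WFA S n) (Q R : Matrix (Fin n) (Fin n) ℝ) : WFA S n :=
  ⟨M.init ᵥ* Q, R *ᵥ M.final, fun a => R * M.trans a * Q⟩

variable {M : WFA S n} {Q R : Matrix (Fin n) (Fin n) ℝ}

theorem matOf_conj (h : Q * R = 1) (x : List S) : (M.conj Q R).matOf x = R * M.matOf x * Q := by
  induction x with
  | nil => simp [matOf, mul_eq_one_comm.mp h]
  | cons a x ih =>
    simp only [matOf, List.map_cons, List.prod_cons] at ih ⊢
    rw [ih]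
    calc R * M.trans a * Q * (R * (List.map M.trans x).prod * Q)
        = R * M.trans a * (Q * R) * (List.map M.trans x).prod * Q := by
          simp only [Matrix.mul_assoc]
      _ = _ := by simp only [h, Matrix.mul_one, Matrix.mul_assoc]

theorem fwd_conj (h : Q * R = 1) (x : List S) : (M.conj Q R).fwd x = M.fwd x ᵥ* Q := by
  rw [fwd, matOf_conj h, conj, fwd, vecMul_vecMul, vecMul_vecMul, Matrix.mul_assoc,
    ← Matrix.mul_assoc Q, h, Matrix.one_mul]

theorem bwd_conj (h : Q * R = 1) (x : List S) : (M.conj Q R).bwd x = R *ᵥ M.bwd x := by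
  rw [bwd, matOf_conj h, conj, bwd, mulVec_mulVec, mulVec_mulVec, Matrix.mul_assoc, h,
    Matrix.mul_one]

theorem f_conj (h : Q * R = 1) : (M.conj Q R).f = M.f := by
  funext x
  rw [← List.append_nil x, f_append, f_append, fwd_conj h, bwd_conj h, ← dotProduct_mulVec,
    mulVec_mulVec, h, one_mulVec]

theorem hasSum_fwd_conj (hG : M.GpDefined) (h : Q * R = 1) (i j : Fin n) :
    HasSum (fun x => (M.conj Q R).fwd x i * (M.conj Q R).fwd x j) ((Qᵀ * M.Gp * Q) i j) := by
  have := hasSum_gram hG (fun k => Q k i) (fun k => Q k j)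
  simp only [fwd_conj h]
  rwa [Matrix.mul_assoc]

theorem hasSum_bwd_conj (hG : M.GsDefined) (h : Q * R = 1) (i j : Fin n) :
    HasSum (fun x => (M.conj Q R).bwd x i * (M.conj Q R).bwd x j) ((R * M.Gs * Rᵀ) i j) := by
  have := hasSum_gram hG (R i) (R j)
  simp only [bwd_conj h, mulVec, dotProduct_comm (R _)]
  rwa [Matrix.mul_assoc]

/-- A rational function is computed by a minimal automaton. -/
theorem _root_.IsRational.exists_min {f : List S → ℝ} (hf : IsRational f) :
    ∃ (n : ℕ) (M : WFA S n), M.f = f ∧ M.Min := by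
  classical
  obtain ⟨M, hM⟩ := Nat.find_spec hf
  exact ⟨Nat.find hf, M, hM, fun m hm => Nat.find_min' hf (hM ▸ hm)⟩

end WFA

/-- a rational function admits an SVA iff it is square-summable. -/
theorem hasSVA_iff_ell_two {S : Type*} [Fintype S] (f : List S → ℝ) (hf : IsRational f) :
    HasSVA f ↔ Summable fun x : List S => f x ^ 2 := by
  refine ⟨HasSVA.summable_sq, fun hsum => ?_⟩
  obtain ⟨n, M, rfl, hM⟩ := hf.exists_min
  have hGp := hM.gpDefined hsum
  have hGs := hM.gsDefined hsum
  obtain ⟨Q, R, σ, hQR, hQ, hR, hσ, hmono⟩ :=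
    (posDef_gram hGp hM.span_fwd).exists_balancing (posDef_gram hGs hM.span_bwd)
  have hsq : ∀ i, √(σ i) ≠ 0 := fun i => (Real.sqrt_pos.mpr (hσ i)).ne'
  have hms : ∀ i, √(σ i) * √(σ i) = σ i := fun i => Real.mul_self_sqrt (hσ i).le
  have normalize : ∀ X : List S → Fin n → ℝ,
      (∀ i j, HasSum (fun x => X x i * X x j) (diagonal σ i j)) →
      ∀ i j, HasSum (fun x => X x i / √(σ i) * (X x j / √(σ j)))
        (if i = j then (1 : ℝ) else 0) := by
    intro X hX i j
    have hval : (if i = j then (1 : ℝ) else 0) = diagonal σ i j / (√(σ i) * √(σ j)) := by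
      split_ifs with hij
      · subst hij
        rw [diagonal_apply_eq, hms, div_self (hσ i).ne']
      · rw [diagonal_apply_ne _ hij, zero_div]
    rw [hval]
    simpa only [div_mul_div_comm] using (hX i j).div_const (√(σ i) * √(σ j))
  have hU := normalize (M.conj Q R).fwd fun i j => hQ ▸ WFA.hasSum_fwd_conj hGp hQR i j
  have hV := normalize (M.conj Q R).bwd fun i j => hR ▸ WFA.hasSum_bwd_conj hGs hQR i j
  refine ⟨n, M.conj Q R, fun x i => (M.conj Q R).fwd x i / √(σ i),
    fun x i => (M.conj Q R).bwd x i / √(σ i), σ, WFA.f_conj hQR, ?_,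
    fun i j => (hU i j).summable, fun i j => (hV i j).summable,
    fun i j => (hU i j).tsum_eq, fun i j => (hV i j).tsum_eq, hσ, fun i j hij => hmono hij,
    fun p s => ?_, fun p i => (div_mul_cancel₀ _ (hsq i)).symm,
    fun s i => (div_mul_cancel₀ _ (hsq i)).symm⟩
  · intro m hm
    exact hM m (WFA.f_conj hQR ▸ hm)
  · rw [← WFA.f_conj hQR, WFA.f_append]
    refine Finset.sum_congr rfl fun i _ => ?_
    calc _ = (M.conj Q R).fwd p i * (M.conj Q R).bwd s i * (σ i / (√(σ i) * √(σ i))) := by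
          rw [hms, div_self (hσ i).ne', mul_one]
      _ = _ := by ring
end

section
/- Let A = ⟨α, β, {A_a}⟩ be a WFA over a finite alphabet Σ. Each of the following conditions implies Σ_{x∈Σ*} f_A(x)² < ∞: (1) Σ_{x∈Σ*} |f_A(x)| < ∞; (2) the spectral radius of Σ_{a∈Σ} A_a ⊗ A_a is less than 1; (3) ‖Σ_{a∈Σ} A_a ⊗ A_a‖_p < 1 for some induced matrix p-norm, 1 ≤ p ≤ ∞; (4) ‖Σ_{a∈Σ} A_a A_aᵀ‖₂ < 1, where ‖·‖₂ is the spectral norm. -/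
open scoped ENNReal
open scoped Kronecker
open Matrix

/-- A nonnegative function on lists is summable once its sums over lists of fixed length are. -/
lemma summable_list_of_summable_length {S : Type*} [Fintype S] {g : List S → ℝ}
    (hg : ∀ x, 0 ≤ g x) (h : Summable fun t : ℕ => ∑ x : Fin t → S, g (List.ofFn x)) :
    Summable g := by
  rw [← List.equivSigmaTuple.symm.summable_iff]
  refine (summable_sigma_of_nonneg fun _ => hg _).2 ⟨fun t => Summable.of_finite, ?_⟩
  simpa [tsum_fintype, List.equivSigmaTuple] using h

lemma sum_fin_succ_ofFn {S E : Type*} [Fintype S] [AddCommMonoid E] (g : List S → E) (t : ℕ) :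
    ∑ x : Fin (t + 1) → S, g (List.ofFn x) =
      ∑ a : S, ∑ x : Fin t → S, g (a :: List.ofFn x) := by
  rw [← (Fin.consEquiv fun _ => S).sum_comp, Fintype.sum_prod_type]
  simp [Fin.consEquiv, List.ofFn_succ]

namespace WFA

variable {S : Type*} {n : ℕ} (M : WFA S n)

@[simp]
lemma matOf_nil : M.matOf [] = 1 := rfl

@[simp]
lemma matOf_cons (a : S) (x : List S) : M.matOf (a :: x) = M.trans a * M.matOf x := by
  simp [matOf]

lemma sum_kronecker_matOf [Fintype S] (t : ℕ) :
    ∑ x : Fin t → S, M.matOf (List.ofFn x) ⊗ₖ M.matOf (List.ofFn x) =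
      (∑ a : S, M.trans a ⊗ₖ M.trans a) ^ t := by
  induction t with
  | zero => simp
  | succ t ih =>
    rw [sum_fin_succ_ofFn fun x => M.matOf x ⊗ₖ M.matOf x, pow_succ', ← ih, Finset.sum_mul_sum]
    simp [Matrix.mul_kronecker_mul]

lemma f_sq_eq (x : List S) :
    M.f x ^ 2 = ∑ i : Fin n × Fin n, ∑ j : Fin n × Fin n,
      M.init i.1 * M.init i.2 * (M.final j.1 * M.final j.2) *
        (M.matOf x ⊗ₖ M.matOf x) i j := by
  have h : M.f x = ∑ i, ∑ j, M.init i * M.matOf x i j * M.final j := by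
    simp [f, dotProduct, mulVec, Finset.mul_sum, mul_assoc]
  rw [sq, h, Finset.sum_mul_sum, Fintype.sum_prod_type]
  refine Finset.sum_congr rfl fun i _ => Finset.sum_congr rfl fun k _ => ?_
  rw [Finset.sum_mul_sum, Fintype.sum_prod_type]
  refine Finset.sum_congr rfl fun j _ => Finset.sum_congr rfl fun l _ => ?_
  simp only [kronecker_apply]
  ring

lemma summable_f_sq_of_summable_pow [Fintype S]
    (h : ∀ i j, Summable fun t : ℕ => ((∑ a : S, M.trans a ⊗ₖ M.trans a) ^ t) i j) :
    Summable fun x => M.f x ^ 2 := by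
  refine summable_list_of_summable_length (fun _ => sq_nonneg _) ?_
  have key : ∀ t : ℕ, ∑ x : Fin t → S, M.f (List.ofFn x) ^ 2 =
      ∑ i : Fin n × Fin n, ∑ j : Fin n × Fin n,
        M.init i.1 * M.init i.2 * (M.final j.1 * M.final j.2) *
          ((∑ a : S, M.trans a ⊗ₖ M.trans a) ^ t) i j := by
    intro t
    simp_rw [f_sq_eq, ← sum_kronecker_matOf, Matrix.sum_apply, Finset.mul_sum]
    rw [Finset.sum_comm]
    exact Finset.sum_congr rfl fun i _ => Finset.sum_comm
  simp_rw [key]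
  exact summable_sum fun i _ => summable_sum fun j _ => (h i j).mul_left _

lemma f_eq_fwd_dotProduct (x : List S) : M.f x = M.fwd x ⬝ᵥ M.final :=
  dotProduct_mulVec _ _ _

lemma sum_vecMul_matOf_le [Fintype S] {r : ℝ} (hr : 0 ≤ r)
    (h : ∀ v, ∑ a : S, (v ᵥ* M.trans a) ⬝ᵥ (v ᵥ* M.trans a) ≤ r * (v ⬝ᵥ v))
    (t : ℕ) (v : Fin n → ℝ) :
    ∑ x : Fin t → S, (v ᵥ* M.matOf (List.ofFn x)) ⬝ᵥ (v ᵥ* M.matOf (List.ofFn x)) ≤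
      r ^ t * (v ⬝ᵥ v) := by
  induction t generalizing v with
  | zero => simp
  | succ t ih =>
    rw [sum_fin_succ_ofFn fun x => (v ᵥ* M.matOf x) ⬝ᵥ (v ᵥ* M.matOf x)]
    simp_rw [matOf_cons, ← vecMul_vecMul]
    calc _ ≤ ∑ a : S, r ^ t * ((v ᵥ* M.trans a) ⬝ᵥ (v ᵥ* M.trans a)) :=
          Finset.sum_le_sum fun a _ => ih _
      _ ≤ r ^ t * (r * (v ⬝ᵥ v)) := by
          rw [← Finset.mul_sum]
          exact mul_le_mul_of_nonneg_left (h v) (pow_nonneg hr t)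
      _ = _ := by ring

lemma summable_f_sq_of_sum_vecMul_le [Fintype S] {r : ℝ} (hr : 0 ≤ r) (hr1 : r < 1)
    (h : ∀ v, ∑ a : S, (v ᵥ* M.trans a) ⬝ᵥ (v ᵥ* M.trans a) ≤ r * (v ⬝ᵥ v)) :
    Summable fun x => M.f x ^ 2 := by
  refine summable_list_of_summable_length (fun _ => sq_nonneg _) ?_
  refine Summable.of_nonneg_of_le (fun t => Finset.sum_nonneg fun _ _ => sq_nonneg _) (fun t => ?_)
    ((summable_geometric_of_lt_one hr hr1).mul_right
      ((M.init ⬝ᵥ M.init) * (M.final ⬝ᵥ M.final)))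
  have hb : 0 ≤ M.final ⬝ᵥ M.final := Finset.sum_nonneg fun _ _ => mul_self_nonneg _
  calc ∑ x : Fin t → S, M.f (List.ofFn x) ^ 2
      ≤ ∑ x : Fin t → S, (M.fwd (List.ofFn x) ⬝ᵥ M.fwd (List.ofFn x)) *
          (M.final ⬝ᵥ M.final) := by
        refine Finset.sum_le_sum fun x _ => ?_
        rw [f_eq_fwd_dotProduct]
        simpa [dotProduct, sq] using
          Finset.sum_mul_sq_le_sq_mul_sq Finset.univ (M.fwd (List.ofFn x)) M.final
    _ ≤ _ := by
        rw [← Finset.sum_mul, ← mul_assoc]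
        exact mul_le_mul_of_nonneg_right (M.sum_vecMul_matOf_le hr h t M.init) hb

end WFA

section

attribute [local instance] Matrix.linftyOpNormedRing Matrix.linftyOpNormedAlgebra

lemma summable_pow_apply_of_specRad_lt_one {d : Type*} [Fintype d] [DecidableEq d]
    {K : Matrix d d ℝ} (h : specRad K < 1) (i j : d) :
    Summable fun t : ℕ => (K ^ t) i j := by
  set L := K.map (algebraMap ℝ ℂ) with hL
  have hentry : ∀ t : ℕ, ‖(K ^ t) i j‖ ≤ ‖L ^ t‖ := by
    intro t
    have h1 : (L ^ t) i j = ((K ^ t) i j : ℂ) := by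
      rw [hL, ← RingHom.mapMatrix_apply, ← map_pow]
      simp
    have h2 : ‖(K ^ t) i j‖ = ‖(L ^ t) i j‖ := by rw [h1, Complex.norm_real]
    rw [h2, Matrix.linfty_opNorm_def]
    have h3 : ‖(L ^ t) i j‖₊ ≤ ∑ j, ‖(L ^ t) i j‖₊ :=
      Finset.single_le_sum (f := fun j => ‖(L ^ t) i j‖₊) (fun _ _ => zero_le) (Finset.mem_univ j)
    have h4 := Finset.le_sup (f := fun i => ∑ j, ‖(L ^ t) i j‖₊) (Finset.mem_univ i)
    exact_mod_cast h3.trans h4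
  obtain ⟨r, hr, hr1⟩ := ENNReal.lt_iff_exists_nnreal_btwn.1 h
  have hev := (spectrum.pow_nnnorm_pow_one_div_tendsto_nhds_spectralRadius L).eventually_lt_const hr
  refine Summable.of_norm_bounded_eventually_nat
    (summable_geometric_of_lt_one r.2 (by exact_mod_cast hr1)) ?_
  filter_upwards [hev, Filter.eventually_gt_atTop 0] with t ht ht0
  refine (hentry t).trans ?_
  have h5 := ENNReal.rpow_lt_rpow ht (z := t) (by positivity)
  rw [← ENNReal.rpow_mul, one_div, inv_mul_cancel₀ (by positivity), ENNReal.rpow_one,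
    ENNReal.rpow_natCast] at h5
  exact_mod_cast h5.le

end

section

variable {d : Type*} [Fintype d] {p : ℝ≥0∞}

lemma vecPNorm_eq_norm (hp : 1 ≤ p) (v : d → ℝ) : vecPNorm p v = ‖WithLp.toLp p v‖ := by
  unfold vecPNorm
  split_ifs with h
  · subst h
    simp [PiLp.norm_eq_ciSup]
  · simp [PiLp.norm_eq_sum (ENNReal.toReal_pos (zero_lt_one.trans_le hp).ne' h)]

lemma inducedPNorm_nonneg (hp : 1 ≤ p) (K : Matrix d d ℝ) : 0 ≤ inducedPNorm p K := by
  refine Real.sSup_nonneg ?_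
  rintro _ ⟨v, -, rfl⟩
  rw [vecPNorm_eq_norm hp]
  have := Fact.mk hp
  exact norm_nonneg _

lemma norm_mulVec_le_inducedPNorm [Fact (1 ≤ p)] (K : Matrix d d ℝ) (v : d → ℝ) :
    ‖WithLp.toLp p (K *ᵥ v)‖ ≤ inducedPNorm p K * ‖WithLp.toLp p v‖ := by
  classical
  have hp : 1 ≤ p := Fact.out
  let T : WithLp p (d → ℝ) →L[ℝ] WithLp p (d → ℝ) :=
    LinearMap.toContinuousLinearMap (Matrix.toLpLin p p K)
  have hT : ∀ w : d → ℝ, WithLp.toLp p (K *ᵥ w) = T (WithLp.toLp p w) := fun w => by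
    simp [T]
  have hbdd : BddAbove {r | ∃ v : d → ℝ, vecPNorm p v = 1 ∧ r = vecPNorm p (K.mulVec v)} := by
    refine ⟨‖T‖, ?_⟩
    rintro _ ⟨w, hw, rfl⟩
    rw [vecPNorm_eq_norm hp] at hw ⊢
    rw [hT]
    simpa [hw] using T.le_opNorm (WithLp.toLp p w)
  rcases eq_or_ne (WithLp.toLp p v) 0 with h0 | h0
  · rw [hT, h0]
    simp
  · have hpos : 0 < ‖WithLp.toLp p v‖ := norm_pos_iff.2 h0
    set c := ‖WithLp.toLp p v‖
    have hle : vecPNorm p (K *ᵥ (c⁻¹ • v)) ≤ inducedPNorm p K := by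
      refine le_csSup hbdd ⟨c⁻¹ • v, ?_, rfl⟩
      rw [vecPNorm_eq_norm hp, WithLp.toLp_smul, norm_smul, norm_inv, Real.norm_of_nonneg hpos.le]
      exact inv_mul_cancel₀ hpos.ne'
    rw [vecPNorm_eq_norm hp, mulVec_smul, WithLp.toLp_smul, norm_smul, norm_inv,
      Real.norm_of_nonneg hpos.le, inv_mul_le_iff₀ hpos] at hle
    linarith

lemma norm_pow_mulVec_le_inducedPNorm [DecidableEq d] [Fact (1 ≤ p)] (K : Matrix d d ℝ)
    (v : d → ℝ) (t : ℕ) :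
    ‖WithLp.toLp p ((K ^ t) *ᵥ v)‖ ≤ inducedPNorm p K ^ t * ‖WithLp.toLp p v‖ := by
  induction t with
  | zero => simp
  | succ t ih =>
    rw [pow_succ', ← mulVec_mulVec, pow_succ', mul_assoc]
    exact (norm_mulVec_le_inducedPNorm K _).trans
      (mul_le_mul_of_nonneg_left ih (inducedPNorm_nonneg Fact.out K))

lemma summable_pow_apply_of_inducedPNorm_lt_one [DecidableEq d] (hp : 1 ≤ p) {K : Matrix d d ℝ}
    (h : inducedPNorm p K < 1) (i j : d) :
    Summable fun t : ℕ => (K ^ t) i j := by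
  have := Fact.mk hp
  refine Summable.of_norm_bounded
    ((summable_geometric_of_lt_one (inducedPNorm_nonneg hp K) h).mul_right
      ‖WithLp.toLp p (Pi.single j 1 : d → ℝ)‖) fun t => ?_
  have h1 := PiLp.norm_apply_le (WithLp.toLp p ((K ^ t) *ᵥ Pi.single j 1)) i
  have h2 := h1.trans (norm_pow_mulVec_le_inducedPNorm K (Pi.single j 1) t)
  simpa using h2

lemma dotProduct_mulVec_le_inducedPNorm (K : Matrix d d ℝ) (v : d → ℝ) :
    v ⬝ᵥ (K *ᵥ v) ≤ inducedPNorm 2 K * (v ⬝ᵥ v) := by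
  have h1 := real_inner_le_norm (WithLp.toLp 2 v) (WithLp.toLp 2 (K *ᵥ v))
  have h2 := norm_mulVec_le_inducedPNorm (p := 2) K v
  have h3 : v ⬝ᵥ v = ‖WithLp.toLp 2 v‖ ^ 2 := by
    rw [EuclideanSpace.real_norm_sq_eq]
    simp [dotProduct, sq]
  rw [EuclideanSpace.inner_toLp_toLp, star_trivial, dotProduct_comm] at h1
  rw [h3]
  nlinarith [mul_le_mul_of_nonneg_left h2 (norm_nonneg (WithLp.toLp 2 v))]

end

/-- sufficient conditions for `f_A ∈ ℓ²`: (1) `f_A ∈ ℓ¹`;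
(2) `ρ(∑_a A_a ⊗ A_a) < 1`; (3) `‖∑_a A_a ⊗ A_a‖_p < 1` for some `1 ≤ p ≤ ∞`;
(4) `‖∑_a A_a A_aᵀ‖₂ < 1`. -/
theorem ell_two_sufficient_conditions {S : Type*} [Fintype S] {n : ℕ} (M : WFA S n)
    (h : (Summable fun x : List S => |M.f x|) ∨
      specRad (∑ a : S, M.trans a ⊗ₖ M.trans a) < 1 ∨
      (∃ p : ℝ≥0∞, 1 ≤ p ∧ inducedPNorm p (∑ a : S, M.trans a ⊗ₖ M.trans a) < 1) ∨
      inducedPNorm 2 (∑ a : S, M.trans a * (M.trans a)ᵀ) < 1) :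
    Summable fun x : List S => M.f x ^ 2 := by
  rcases h with h | h | ⟨p, hp, h⟩ | h
  · refine Summable.of_norm_bounded_eventually h ?_
    filter_upwards [h.tendsto_cofinite_zero.eventually_le_const zero_lt_one] with x hx
    rw [Real.norm_of_nonneg (sq_nonneg _), ← sq_abs]
    nlinarith [abs_nonneg (M.f x)]
  · exact M.summable_f_sq_of_summable_pow (summable_pow_apply_of_specRad_lt_one h)
  · exact M.summable_f_sq_of_summable_pow (summable_pow_apply_of_inducedPNorm_lt_one hp h)
  · refine M.summable_f_sq_of_sum_vecMul_le (inducedPNorm_nonneg one_le_two _) h fun v => ?_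
    refine le_of_eq_of_le ?_ (dotProduct_mulVec_le_inducedPNorm _ v)
    rw [sum_mulVec, dotProduct_sum]
    refine Finset.sum_congr rfl fun a _ => ?_
    rw [← mulVec_mulVec, dotProduct_mulVec, mulVec_transpose]
end
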